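/- arXiv:1701.04394 — 3 statements merged into one kernel-verified Lean document; each statement's English description precedes it below -/
import Mathlib

section
/- The eigenspace of σ for the eigenvalue 1 is exactly the linear span of the vectors e_i ⊗ e_i for 1 ≤ i ≤ n together with the vectors e_i ⊗ e_j + q e_j ⊗ e_i for 1 ≤ i < j ≤ n; that is, ker(σ − id) = span_ℂ{ e_i ⊗ e_i (1 ≤ i ≤ n), e_i ⊗ e_j + q e_j ⊗ e_i (1 ≤ i < j ≤ n) }, and this subspace has dimension n(n+1)/2. -/
open TensorProduct

/-- The standard basis vector `e i` of `ℂⁿ`. -/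
noncomputable def e (n : ℕ) (i : Fin n) : Fin n → ℂ := Pi.single i 1

/-- Spanning family indexed by pairs `i ≤ j`. -/
noncomputable def vfam (q : ℂ) (n : ℕ) (p : {p : Fin n × Fin n // p.1 ≤ p.2}) :
    (Fin n → ℂ) ⊗[ℂ] (Fin n → ℂ) :=
  if p.1.1 = p.1.2 then e n p.1.1 ⊗ₜ[ℂ] e n p.1.2
  else e n p.1.1 ⊗ₜ[ℂ] e n p.1.2 + q • (e n p.1.2 ⊗ₜ[ℂ] e n p.1.1)

/-- The tensor basis. -/
noncomputable def tb (n : ℕ) : Module.Basis (Fin n × Fin n) ℂ ((Fin n → ℂ) ⊗[ℂ] (Fin n → ℂ)) :=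
  (Pi.basisFun ℂ (Fin n)).tensorProduct (Pi.basisFun ℂ (Fin n))

theorem tb_apply (n : ℕ) (i j : Fin n) : tb n (i, j) = e n i ⊗ₜ[ℂ] e n j := by
  simp [tb, e, Module.Basis.tensorProduct_apply]

theorem coord_vfam (q : ℂ) (n : ℕ) (p p' : {p : Fin n × Fin n // p.1 ≤ p.2}) :
    (tb n).coord p.1 (vfam q n p') = if p = p' then 1 else 0 := by
  obtain ⟨⟨i, j⟩, h⟩ := p
  obtain ⟨⟨k, l⟩, h'⟩ := p'
  simp only [vfam, ← tb_apply]
  dsimp only at h h'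
  by_cases hkl : k = l
  · simp [hkl, Finsupp.single_apply, eq_comm]
  · have : ¬ (l = i ∧ k = j) := by
      rintro ⟨rfl, rfl⟩
      exact hkl (le_antisymm h' h)
    simp [hkl, Finsupp.single_apply, this, eq_comm]
    try grind

theorem vfam_li (q : ℂ) (n : ℕ) : LinearIndependent ℂ (vfam q n) := by
  rw [Fintype.linearIndependent_iff]
  intro g hg p
  have := congrArg ((tb n).coord p.1) hg
  rw [map_sum] at this
  simpa only [map_smul, coord_vfam, smul_eq_mul, mul_ite, mul_one, mul_zero,
    Finset.sum_ite_eq, Finset.mem_univ, if_true, map_zero] using this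

theorem vfam_range (q : ℂ) (n : ℕ) : Set.range (vfam q n) =
    ({x | ∃ i : Fin n, x = e n i ⊗ₜ[ℂ] e n i} ∪
           {x | ∃ i j : Fin n, i < j ∧
              x = e n i ⊗ₜ[ℂ] e n j + q • (e n j ⊗ₜ[ℂ] e n i)}) := by
  ext x
  constructor
  · rintro ⟨⟨⟨i, j⟩, h⟩, rfl⟩
    dsimp only at h
    by_cases hij : i = j
    · subst hij
      left
      exact ⟨i, by simp [vfam]⟩
    · right
      exact ⟨i, j, lt_of_le_of_ne h hij, by simp [vfam, hij]⟩
  · rintro (⟨i, rfl⟩ | ⟨i, j, h, rfl⟩)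
    · exact ⟨⟨(i, i), le_rfl⟩, by simp [vfam]⟩
    · exact ⟨⟨(i, j), h.le⟩, by simp [vfam, h.ne]⟩

theorem mem_diag (q : ℂ) (n : ℕ) (i : Fin n) :
    e n i ⊗ₜ[ℂ] e n i ∈ Submodule.span ℂ (Set.range (vfam q n)) := by
  apply Submodule.subset_span
  rw [vfam_range]
  exact Or.inl ⟨i, rfl⟩

theorem mem_off (q : ℂ) (n : ℕ) (i j : Fin n) (h : i < j) :
    e n i ⊗ₜ[ℂ] e n j + q • (e n j ⊗ₜ[ℂ] e n i) ∈ Submodule.span ℂ (Set.range (vfam q n)) := by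
  apply Submodule.subset_span
  rw [vfam_range]
  exact Or.inr ⟨i, j, h, rfl⟩

/-- the eigenspace of `σ` for the eigenvalue `1` is exactly
`span_ℂ{ e_i ⊗ e_i (1 ≤ i ≤ n), e_i ⊗ e_j + q e_j ⊗ e_i (1 ≤ i < j ≤ n) }`,
and this subspace has dimension `n(n+1)/2`. -/
theorem sigma_eigenspace_one (q : ℝ) (hq0 : 0 < q) (hq1 : q < 1)
    (n : ℕ) (hn : 1 ≤ n)
    (σ : (Fin n → ℂ) ⊗[ℂ] (Fin n → ℂ) →ₗ[ℂ] (Fin n → ℂ) ⊗[ℂ] (Fin n → ℂ))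
    (hdiag : ∀ i : Fin n, σ (e n i ⊗ₜ[ℂ] e n i) = e n i ⊗ₜ[ℂ] e n i)
    (hlt : ∀ i j : Fin n, i < j →
      σ (e n i ⊗ₜ[ℂ] e n j) = ((q : ℂ))⁻¹ • (e n j ⊗ₜ[ℂ] e n i))
    (hgt : ∀ i j : Fin n, i < j →
      σ (e n j ⊗ₜ[ℂ] e n i) =
        ((q : ℂ))⁻¹ • (e n i ⊗ₜ[ℂ] e n j)
          + (1 - (((q : ℂ)) ^ 2)⁻¹) • (e n j ⊗ₜ[ℂ] e n i)) :
    LinearMap.ker (σ - LinearMap.id)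
      = Submodule.span ℂ
          ({x | ∃ i : Fin n, x = e n i ⊗ₜ[ℂ] e n i} ∪
           {x | ∃ i j : Fin n, i < j ∧
              x = e n i ⊗ₜ[ℂ] e n j + (q : ℂ) • (e n j ⊗ₜ[ℂ] e n i)}) ∧
    Module.finrank ℂ (LinearMap.ker (σ - LinearMap.id)) = n * (n + 1) / 2 := by
  have hq : (q : ℂ) ≠ 0 := by exact_mod_cast hq0.ne'
  rw [← vfam_range]
  have key : LinearMap.ker (σ - LinearMap.id) = Submodule.span ℂ (Set.range (vfam (q : ℂ) n)) := by
    apply le_antisymm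
    · intro x hx
      have hx' : σ x = x := by simpa [sub_eq_zero] using hx
      have all : ∀ y, σ y + ((q : ℂ) ^ 2)⁻¹ • y ∈
          Submodule.span ℂ (Set.range (vfam (q : ℂ) n)) := by
        have hle : (⊤ : Submodule ℂ ((Fin n → ℂ) ⊗[ℂ] (Fin n → ℂ))) ≤
            (Submodule.span ℂ (Set.range (vfam (q : ℂ) n))).comap
              (σ + ((q : ℂ) ^ 2)⁻¹ • LinearMap.id) := by
          rw [← (tb n).span_eq, Submodule.span_le]
          rintro _ ⟨⟨i, j⟩, rfl⟩
          simp only [tb_apply, SetLike.mem_coe, Submodule.mem_comap, LinearMap.add_apply,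
            LinearMap.smul_apply, LinearMap.id_apply]
          rcases lt_trichotomy i j with h | h | h
          · have := Submodule.smul_mem _ ((q : ℂ) ^ 2)⁻¹ (mem_off (q : ℂ) n i j h)
            convert this using 1
            rw [hlt i j h]
            match_scalars <;> field_simp
          · subst h
            rw [hdiag]
            have hm := mem_diag (q : ℂ) n i
            exact Submodule.add_mem _ hm (Submodule.smul_mem _ _ hm)
          · have := Submodule.smul_mem _ ((q : ℂ))⁻¹ (mem_off (q : ℂ) n j i h)
            convert this using 1
            rw [hgt j i h]
            match_scalars <;> field_simp <;> ring
        intro y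
        exact hle (Submodule.mem_top (x := y))
      have h1 := all x
      rw [hx'] at h1
      have hc : (1 + ((q : ℂ) ^ 2)⁻¹) ≠ 0 := by
        have : (1 + (q ^ 2)⁻¹ : ℝ) ≠ 0 := by positivity
        exact_mod_cast this
      have h2 : (1 + ((q : ℂ) ^ 2)⁻¹) • x ∈ Submodule.span ℂ (Set.range (vfam (q : ℂ) n)) := by
        rwa [add_smul, one_smul]
      exact (Submodule.smul_mem_iff _ hc).1 h2
    · rw [Submodule.span_le, vfam_range]
      rintro _ (⟨i, rfl⟩ | ⟨i, j, h, rfl⟩)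
      · simp [hdiag]
      · simp only [SetLike.mem_coe, LinearMap.mem_ker, LinearMap.sub_apply, LinearMap.id_apply,
          map_add, map_smul, hlt i j h, hgt i j h]
        match_scalars <;> field_simp <;> ring
  refine ⟨key, ?_⟩
  rw [key, finrank_span_eq_card (vfam_li _ n), ← Fintype.card_congr Sym2.sortEquiv, Sym2.card,
    Fintype.card_fin, Nat.choose_two_right, Nat.add_sub_cancel, Nat.mul_comm]
end

section
/- The tensor square V ⊗ V decomposes as the internal direct sum of the two eigenspaces of σ: V ⊗ V = ker(σ − id) ⊕ ker(σ + q⁻² id), where the first summand has dimension n(n+1)/2 and the second has dimension n(n−1)/2. In particular σ is diagonalizable with at most the two eigenvalues 1 and −q⁻², and for n ≥ 2 it has exactly these two eigenvalues. -/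
open TensorProduct

theorem card_lt_pairs (n : ℕ) :
    2 * (Finset.univ.filter (fun p : Fin n × Fin n => p.1 < p.2)).card + n = n * n := by
  have h1 : (Finset.univ.filter (fun p : Fin n × Fin n => p.1 < p.2)).card
      = (Finset.univ.filter (fun p : Fin n × Fin n => p.2 < p.1)).card := by
    apply Finset.card_bij (fun p _ => (p.2, p.1))
    · intro p hp; simpa using hp
    · rintro ⟨a, b⟩ _ ⟨c, d⟩ _ h
      simp only [Prod.mk.injEq] at h ⊢
      exact ⟨h.2, h.1⟩
    · rintro ⟨a, b⟩ hp
      exact ⟨(b, a), by simpa using hp, rfl⟩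
  have h2 : (Finset.univ.filter (fun p : Fin n × Fin n => p.1 = p.2)).card = n := by
    have : Finset.univ.filter (fun p : Fin n × Fin n => p.1 = p.2)
        = Finset.univ.image (fun i : Fin n => (i, i)) := by
      ext ⟨a, b⟩
      simp [Prod.ext_iff]
    rw [this, Finset.card_image_of_injective _ (fun a b h => (Prod.ext_iff.1 h).1)]
    simp
  have h3 : (Finset.univ : Finset (Fin n × Fin n)).card = n * n := by simp
  have h4 : (Finset.univ : Finset (Fin n × Fin n)) =
      (Finset.univ.filter (fun p : Fin n × Fin n => p.1 < p.2)
        ∪ Finset.univ.filter (fun p : Fin n × Fin n => p.2 < p.1))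
        ∪ Finset.univ.filter (fun p : Fin n × Fin n => p.1 = p.2) := by
    ext ⟨a, b⟩
    simp only [Finset.mem_union, Finset.mem_filter, Finset.mem_univ, true_and, true_iff]
    rcases lt_trichotomy a b with h | h | h <;> simp [h]
  rw [h4, Finset.card_union_of_disjoint, Finset.card_union_of_disjoint, ← h1, h2] at h3
  · omega
  · rw [Finset.disjoint_left]; rintro ⟨a, b⟩ h h'; simp at h h'; omega
  · rw [Finset.disjoint_left]; rintro ⟨a, b⟩ h h'; simp at h h'; omega

theorem card_le_pairs (n : ℕ) :
    (Finset.univ.filter (fun p : Fin n × Fin n => p.1 ≤ p.2)).card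
      + (Finset.univ.filter (fun p : Fin n × Fin n => p.1 < p.2)).card = n * n := by
  have h1 : (Finset.univ.filter (fun p : Fin n × Fin n => p.1 < p.2)).card
      = (Finset.univ.filter (fun p : Fin n × Fin n => ¬ p.1 ≤ p.2)).card := by
    apply Finset.card_bij (fun p _ => (p.2, p.1))
    · intro p hp; simpa using hp
    · rintro ⟨a, b⟩ _ ⟨c, d⟩ _ h
      simp only [Prod.mk.injEq] at h ⊢
      exact ⟨h.2, h.1⟩
    · rintro ⟨a, b⟩ hp
      exact ⟨(b, a), by simpa using hp, rfl⟩
  rw [h1, Finset.card_filter_add_card_filter_not]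
  simp

/-- A linear map whose values on the basis tensors lie in the span of a finite family has small
range. -/
theorem range_bound (n : ℕ)
    (f : (Fin n → ℂ) ⊗[ℂ] (Fin n → ℂ) →ₗ[ℂ] (Fin n → ℂ) ⊗[ℂ] (Fin n → ℂ))
    (s : Finset (Fin n × Fin n)) (w : Fin n × Fin n → (Fin n → ℂ) ⊗[ℂ] (Fin n → ℂ))
    (h : ∀ i j, f (e n i ⊗ₜ[ℂ] e n j) ∈ Submodule.span ℂ (w '' (s : Set (Fin n × Fin n)))) :
    Module.finrank ℂ (LinearMap.range f) ≤ s.card := by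
  classical
  have h1 : LinearMap.range f ≤ Submodule.span ℂ ((s.image w : Finset _) : Set _) := by
    rw [Finset.coe_image]
    have hb := ((Pi.basisFun ℂ (Fin n)).tensorProduct (Pi.basisFun ℂ (Fin n))).span_eq
    rw [LinearMap.range_eq_map, ← hb, Submodule.map_span_le]
    rintro _ ⟨⟨i, j⟩, rfl⟩
    have := h i j
    simpa [Module.Basis.tensorProduct_apply, e] using this
  exact (Submodule.finrank_mono h1).trans
    ((finrank_span_finset_le_card _).trans Finset.card_image_le)

/-- `V ⊗ V` decomposes as the internal direct sum of the two eigenspaces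
`ker(σ - id)` (dimension `n(n+1)/2`) and `ker(σ + q⁻² id)` (dimension `n(n-1)/2`);
in particular `σ` is diagonalizable with at most the two eigenvalues `1` and `-q⁻²`,
and for `n ≥ 2` it has exactly these two eigenvalues. -/
theorem sigma_eigenspace_decomposition (q : ℝ) (hq0 : 0 < q) (hq1 : q < 1)
    (n : ℕ) (hn : 1 ≤ n)
    (σ : (Fin n → ℂ) ⊗[ℂ] (Fin n → ℂ) →ₗ[ℂ] (Fin n → ℂ) ⊗[ℂ] (Fin n → ℂ))
    (hdiag : ∀ i : Fin n, σ (e n i ⊗ₜ[ℂ] e n i) = e n i ⊗ₜ[ℂ] e n i)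
    (hlt : ∀ i j : Fin n, i < j →
      σ (e n i ⊗ₜ[ℂ] e n j) = ((q : ℂ))⁻¹ • (e n j ⊗ₜ[ℂ] e n i))
    (hgt : ∀ i j : Fin n, i < j →
      σ (e n j ⊗ₜ[ℂ] e n i) =
        ((q : ℂ))⁻¹ • (e n i ⊗ₜ[ℂ] e n j)
          + (1 - (((q : ℂ)) ^ 2)⁻¹) • (e n j ⊗ₜ[ℂ] e n i)) :
    IsCompl (LinearMap.ker (σ - LinearMap.id))
        (LinearMap.ker (σ + (((q : ℂ)) ^ 2)⁻¹ • LinearMap.id)) ∧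
    Module.finrank ℂ (LinearMap.ker (σ - LinearMap.id)) = n * (n + 1) / 2 ∧
    Module.finrank ℂ (LinearMap.ker (σ + (((q : ℂ)) ^ 2)⁻¹ • LinearMap.id))
      = n * (n - 1) / 2 ∧
    (∀ μ : ℂ, Module.End.HasEigenvalue σ μ → μ = 1 ∨ μ = -(((q : ℂ)) ^ 2)⁻¹) ∧
    (2 ≤ n → Module.End.HasEigenvalue σ 1 ∧
      Module.End.HasEigenvalue σ (-(((q : ℂ)) ^ 2)⁻¹)) := by
  have hq : (q : ℂ) ≠ 0 := by exact_mod_cast hq0.ne'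
  set c : ℂ := ((q : ℂ) ^ 2)⁻¹ with hc
  have hc1 : 1 + c ≠ 0 := by
    have : (0 : ℝ) < 1 + (q ^ 2)⁻¹ := by positivity
    rw [hc]
    exact_mod_cast this.ne'
  have hcq : (q : ℂ)⁻¹ * (q : ℂ)⁻¹ = c := by rw [hc]; field_simp
  have hquad : ∀ v, σ (σ v) = (1 - c) • σ v + c • v := by
    have : σ ∘ₗ σ = (1 - c) • σ + c • LinearMap.id := by
      apply ((Pi.basisFun ℂ (Fin n)).tensorProduct (Pi.basisFun ℂ (Fin n))).ext
      rintro ⟨i, j⟩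
      rw [Module.Basis.tensorProduct_apply, Pi.basisFun_apply, Pi.basisFun_apply]
      change σ (σ (e n i ⊗ₜ[ℂ] e n j)) = (1 - c) • σ (e n i ⊗ₜ[ℂ] e n j) + c • (e n i ⊗ₜ[ℂ] e n j)
      rcases lt_trichotomy i j with h | h | h
      · rw [hlt i j h, map_smul, hgt i j h, ← hcq]
        module
      · subst h
        rw [hdiag, hdiag]; module
      · rw [hgt j i h, map_add, map_smul, map_smul, hgt j i h, hlt j i h, ← hcq]
        module
    intro v
    exact LinearMap.congr_fun this v
  have m1 : ∀ v, v ∈ LinearMap.ker (σ - LinearMap.id) ↔ σ v = v := by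
    intro v; simp [sub_eq_zero]
  have m2 : ∀ v, v ∈ LinearMap.ker (σ + c • LinearMap.id) ↔ σ v = -(c • v) := by
    intro v; simp [add_eq_zero_iff_eq_neg]
  have hcompl : IsCompl (LinearMap.ker (σ - LinearMap.id))
      (LinearMap.ker (σ + c • LinearMap.id)) := by
    constructor
    · rw [Submodule.disjoint_def]
      intro v h1 h2
      rw [m1] at h1
      rw [m2, h1] at h2
      have : (1 + c) • v = 0 := by
        rw [add_smul, one_smul]; nth_rewrite 1 [h2]; simp
      exact (smul_eq_zero.1 this).resolve_left hc1
    · rw [codisjoint_iff, eq_top_iff]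
      intro v _
      rw [Submodule.mem_sup]
      refine ⟨(1 + c)⁻¹ • (σ v + c • v), ?_, (1 + c)⁻¹ • (v - σ v), ?_, ?_⟩
      · rw [m1, map_smul, map_add, map_smul, hquad]
        module
      · rw [m2, map_smul, map_sub, hquad]
        module
      · rw [← smul_add]
        have : σ v + c • v + (v - σ v) = (1 + c) • v := by module
        rw [this, smul_smul, inv_mul_cancel₀ hc1, one_smul]
  have hsum := Submodule.finrank_add_eq_of_isCompl hcompl
  have htot : Module.finrank ℂ ((Fin n → ℂ) ⊗[ℂ] (Fin n → ℂ)) = n * n := by simp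
  rw [htot] at hsum
  have b1 : Module.finrank ℂ (LinearMap.ker (σ - LinearMap.id)) ≤
      (Finset.univ.filter (fun p : Fin n × Fin n => p.1 ≤ p.2)).card := by
    refine (Submodule.finrank_mono (t := LinearMap.range (σ + c • LinearMap.id)) ?_).trans
      (range_bound n _ _
        (fun p => e n p.1 ⊗ₜ[ℂ] e n p.2 + (q : ℂ) • (e n p.2 ⊗ₜ[ℂ] e n p.1)) ?_)
    · intro v hv
      rw [m1] at hv
      refine ⟨(1 + c)⁻¹ • v, ?_⟩
      have : (σ + c • LinearMap.id : _ →ₗ[ℂ] _) v = (1 + c) • v := by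
        simp only [LinearMap.add_apply, LinearMap.smul_apply, LinearMap.id_apply, hv]
        module
      rw [map_smul, this, smul_smul, inv_mul_cancel₀ hc1, one_smul]
    · intro i j
      simp only [LinearMap.add_apply, LinearMap.smul_apply, LinearMap.id_apply]
      rcases lt_trichotomy i j with h | h | h
      · have hm := Submodule.smul_mem _ c (Submodule.subset_span (R := ℂ)
          (Set.mem_image_of_mem (fun p : Fin n × Fin n => e n p.1 ⊗ₜ[ℂ] e n p.2
            + (q : ℂ) • (e n p.2 ⊗ₜ[ℂ] e n p.1)) (show (i, j) ∈ ((Finset.univ.filter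
              (fun p : Fin n × Fin n => p.1 ≤ p.2) : Finset _) : Set _) by simpa using h.le)))
        convert hm using 1
        have : c * q = (q : ℂ)⁻¹ := by rw [hc]; field_simp
        rw [hlt i j h, ← this]
        module
      · subst h
        have hq2 : (1 : ℂ) + q ≠ 0 := by
          have : (0 : ℝ) < 1 + q := by positivity
          exact_mod_cast this.ne'
        have hm := Submodule.smul_mem _ ((1 + c) * (1 + (q : ℂ))⁻¹) (Submodule.subset_span (R := ℂ)
          (Set.mem_image_of_mem (fun p : Fin n × Fin n => e n p.1 ⊗ₜ[ℂ] e n p.2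
            + (q : ℂ) • (e n p.2 ⊗ₜ[ℂ] e n p.1)) (show (i, i) ∈ ((Finset.univ.filter
              (fun p : Fin n × Fin n => p.1 ≤ p.2) : Finset _) : Set _) by simp)))
        convert hm using 1
        have : ∀ x : (Fin n → ℂ) ⊗[ℂ] (Fin n → ℂ), x + (q : ℂ) • x = (1 + (q : ℂ)) • x := by
          intro x; module
        simp only [this]
        rw [hdiag, smul_smul, mul_assoc, inv_mul_cancel₀ hq2]
        module
      · have hm := Submodule.smul_mem _ (q : ℂ)⁻¹ (Submodule.subset_span (R := ℂ)
          (Set.mem_image_of_mem (fun p : Fin n × Fin n => e n p.1 ⊗ₜ[ℂ] e n p.2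
            + (q : ℂ) • (e n p.2 ⊗ₜ[ℂ] e n p.1)) (show (j, i) ∈ ((Finset.univ.filter
              (fun p : Fin n × Fin n => p.1 ≤ p.2) : Finset _) : Set _) by simpa using h.le)))
        convert hm using 1
        rw [hgt j i h, smul_add, smul_smul _ (q : ℂ), inv_mul_cancel₀ hq]
        module
  have b2 : Module.finrank ℂ (LinearMap.ker (σ + c • LinearMap.id)) ≤
      (Finset.univ.filter (fun p : Fin n × Fin n => p.1 < p.2)).card := by
    refine (Submodule.finrank_mono (t := LinearMap.range (σ - LinearMap.id)) ?_).trans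
      (range_bound n _ _
        (fun p => e n p.1 ⊗ₜ[ℂ] e n p.2 - (q : ℂ)⁻¹ • (e n p.2 ⊗ₜ[ℂ] e n p.1)) ?_)
    · intro v hv
      rw [m2] at hv
      refine ⟨(-(1 + c)⁻¹) • v, ?_⟩
      have : (σ - LinearMap.id : _ →ₗ[ℂ] _) v = (-(1 + c)) • v := by
        simp only [LinearMap.sub_apply, LinearMap.id_apply, hv]
        module
      rw [map_smul, this, smul_smul, neg_mul_neg, inv_mul_cancel₀ hc1, one_smul]
    · intro i j
      simp only [LinearMap.sub_apply, LinearMap.id_apply]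
      rcases lt_trichotomy i j with h | h | h
      · have hm := Submodule.smul_mem _ (-1 : ℂ) (Submodule.subset_span (R := ℂ)
          (Set.mem_image_of_mem (fun p : Fin n × Fin n => e n p.1 ⊗ₜ[ℂ] e n p.2
            - (q : ℂ)⁻¹ • (e n p.2 ⊗ₜ[ℂ] e n p.1)) (show (i, j) ∈ ((Finset.univ.filter
              (fun p : Fin n × Fin n => p.1 < p.2) : Finset _) : Set _) by simpa using h)))
        convert hm using 1
        rw [hlt i j h]
        module
      · subst h
        rw [hdiag, sub_self]
        exact Submodule.zero_mem _
      · have hm := Submodule.smul_mem _ (q : ℂ)⁻¹ (Submodule.subset_span (R := ℂ)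
          (Set.mem_image_of_mem (fun p : Fin n × Fin n => e n p.1 ⊗ₜ[ℂ] e n p.2
            - (q : ℂ)⁻¹ • (e n p.2 ⊗ₜ[ℂ] e n p.1)) (show (j, i) ∈ ((Finset.univ.filter
              (fun p : Fin n × Fin n => p.1 < p.2) : Finset _) : Set _) by simpa using h)))
        convert hm using 1
        rw [hgt j i h, ← hcq]
        module
  have c1 := card_lt_pairs n
  have c2 := card_le_pairs n
  have e1 : n * (n + 1) = n * n + n := by ring
  have e2 : n * (n - 1) = n * n - n := by rw [Nat.mul_sub, mul_one]
  have d1 : Module.finrank ℂ (LinearMap.ker (σ - LinearMap.id)) = n * (n + 1) / 2 := by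
    rw [e1]; omega
  have d2 : Module.finrank ℂ (LinearMap.ker (σ + c • LinearMap.id)) = n * (n - 1) / 2 := by
    rw [e2]; omega
  refine ⟨hcompl, d1, d2, ?_, ?_⟩
  · intro μ hμ
    obtain ⟨v, hv⟩ := hμ.exists_hasEigenvector
    have hv1 := hv.apply_eq_smul
    have h := hquad v
    rw [hv1, map_smul, hv1] at h
    have h0 : ((μ - 1) * (μ + c)) • v = 0 := by
      have : ((μ - 1) * (μ + c)) • v = μ • μ • v - ((1 - c) • μ • v + c • v) := by module
      rw [this, h, sub_self]
    rcases mul_eq_zero.1 ((smul_eq_zero.1 h0).resolve_right hv.2) with h | h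
    · left; exact sub_eq_zero.1 h
    · right; exact eq_neg_of_add_eq_zero_left h
  · intro hn2
    have hnn : 2 * n ≤ n * n := Nat.mul_le_mul_right n hn2
    have key : ∀ (μ : ℂ) (K : Submodule ℂ ((Fin n → ℂ) ⊗[ℂ] (Fin n → ℂ))),
        0 < Module.finrank ℂ K → (∀ v ∈ K, σ v = μ • v) → Module.End.HasEigenvalue σ μ := by
      intro μ K hK hKv
      have hne : K ≠ ⊥ := by
        rintro rfl
        simp at hK
      obtain ⟨v, hv, hv0⟩ := K.exists_mem_ne_zero_of_ne_bot hne
      exact Module.End.hasEigenvalue_of_hasEigenvector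
        (x := v) ⟨Module.End.mem_eigenspace_iff.2 (hKv v hv), hv0⟩
    constructor
    · refine key 1 _ (by rw [d1, e1]; omega) (fun v hv => ?_)
      rw [(m1 v).1 hv, one_smul]
    · refine key (-c) _ (by rw [d2, e2]; omega) (fun v hv => ?_)
      rw [(m2 v).1 hv]; module
end

section
/- For each 0 ≤ k ≤ n, the ℂ-subspace of Λ_q(n) spanned by the images of all length-k monomials x_{j_1} x_{j_2} ⋯ x_{j_k} (with arbitrary indices j_1, …, j_k ∈ {1, …, n}) has dimension equal to the binomial coefficient C(n, k); in particular the subspace spanned by images of length-n monomials is one-dimensional, spanned by x_1 x_2 ⋯ x_n, and the subspace spanned by images of monomials of length n + 1 is zero. -/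
/-- The defining relations of the quantum exterior algebra `Λ_q(n)`: the two-sided
ideal generated by `x_i²` for all `i` and `x_i x_j + q x_j x_i` for `i < j`. -/
inductive LambdaRel (q : ℝ) (n : ℕ) :
    FreeAlgebra ℂ (Fin n) → FreeAlgebra ℂ (Fin n) → Prop
  | sq (i : Fin n) : LambdaRel q n (FreeAlgebra.ι ℂ i * FreeAlgebra.ι ℂ i) 0
  | comm (i j : Fin n) (h : i < j) :
      LambdaRel q n
        (FreeAlgebra.ι ℂ i * FreeAlgebra.ι ℂ j
          + (q : ℂ) • (FreeAlgebra.ι ℂ j * FreeAlgebra.ι ℂ i)) 0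

/-- The quantum exterior algebra
`Λ_q(n) = ℂ⟨x_1, …, x_n⟩ / ⟨ x_i², x_i x_j + q x_j x_i (i < j) ⟩`. -/
abbrev Lambda (q : ℝ) (n : ℕ) := RingQuot (LambdaRel q n)

/-- The span in `Λ_q(n)` of the images of all length-`k` monomials
`x_{j_1} x_{j_2} ⋯ x_{j_k}` with arbitrary indices `j_1, …, j_k ∈ {1, …, n}`. -/
noncomputable def lambdaDegree (q : ℝ) (n k : ℕ) : Submodule ℂ (Lambda q n) :=
  Submodule.span ℂ
    {y : Lambda q n | ∃ w : Fin k → Fin n,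
      y = RingQuot.mkAlgHom ℂ (LambdaRel q n)
            ((List.ofFn w).map (FreeAlgebra.ι ℂ)).prod}

namespace LambdaAux

open Finset

variable (q : ℝ) (n : ℕ)

noncomputable def X (i : Fin n) : Lambda q n :=
  RingQuot.mkAlgHom ℂ (LambdaRel q n) (FreeAlgebra.ι ℂ i)

noncomputable def xS (S : Finset (Fin n)) : Lambda q n :=
  ((S.sort (· ≤ ·)).map (X q n)).prod

noncomputable def co (i : Fin n) (S : Finset (Fin n)) : ℂ :=
  (-(q : ℂ)⁻¹) ^ (S.filter (· < i)).card

theorem X_sq (i : Fin n) : X q n i * X q n i = 0 := by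
  have h := RingQuot.mkAlgHom_rel ℂ (LambdaRel.sq (q := q) i)
  simpa [X] using h

theorem X_comm (hq : q ≠ 0) (i j : Fin n) (h : i < j) :
    X q n j * X q n i = (-(q : ℂ)⁻¹) • (X q n i * X q n j) := by
  have h := RingQuot.mkAlgHom_rel ℂ (LambdaRel.comm (q := q) i j h)
  rw [map_add, map_smul, map_mul, map_mul, map_zero] at h
  change X q n i * X q n j + (q : ℂ) • (X q n j * X q n i) = 0 at h
  have hq' : (q : ℂ) ≠ 0 := by exact_mod_cast hq
  have h2 : (-(q : ℂ)⁻¹) • (X q n i * X q n j) + (q : ℂ)⁻¹ • (X q n i * X q n j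
      + (q : ℂ) • (X q n j * X q n i)) = X q n j * X q n i := by
    rw [smul_add, smul_smul, inv_mul_cancel₀ hq', one_smul, ← add_assoc, ← add_smul,
      neg_add_cancel, zero_smul, zero_add]
  rw [h, smul_zero, add_zero] at h2
  exact h2.symm

theorem xS_insert_min (a : Fin n) (S : Finset (Fin n)) (h : ∀ b ∈ S, a < b) :
    xS q n (insert a S) = X q n a * xS q n S := by
  unfold xS
  rw [Finset.sort_insert (r := (· ≤ ·)) (fun b hb => (h b hb).le) (fun ha => lt_irrefl _ (h a ha))]
  simp

theorem X_mul_xS (hq : q ≠ 0) (i : Fin n) (S : Finset (Fin n)) :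
    X q n i * xS q n S = if i ∈ S then 0 else co q n i S • xS q n (insert i S) := by
  induction S using Finset.induction_on_min with
  | empty => simp [co, xS]
  | insert a T haT ih =>
    rcases lt_trichotomy i a with h | h | h
    · have hlt : ∀ b ∈ insert a T, i < b := by
        intro b hb
        rcases Finset.mem_insert.1 hb with rfl | hb
        · exact h
        · exact h.trans (haT b hb)
      have hi : i ∉ insert a T := fun hi => lt_irrefl _ (hlt i hi)
      have hf : (insert a T).filter (· < i) = ∅ := by
        apply Finset.filter_eq_empty_iff.2
        intro b hb
        exact (hlt b hb).le.not_gt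
      rw [if_neg hi, xS_insert_min q n i _ hlt, co, hf]
      simp
    · subst h
      rw [if_pos (Finset.mem_insert_self _ _), xS_insert_min q n i _ haT, ← mul_assoc, X_sq, zero_mul]
    · rw [xS_insert_min q n a _ haT, ← mul_assoc, X_comm q n hq a i h, smul_mul_assoc, mul_assoc, ih]
      have haT' : a ∉ T := fun ha => lt_irrefl _ (haT a ha)
      by_cases hi : i ∈ T
      · simp [hi]
      · have hi' : i ∉ insert a T := by
          rw [Finset.mem_insert]; rintro (rfl | h')
          · exact lt_irrefl _ h
          · exact hi h'
        rw [if_neg hi, if_neg hi', mul_smul_comm, ← xS_insert_min q n a (insert i T),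
          smul_smul, Finset.insert_comm a i]
        · congr 1
          simp only [co]
          rw [Finset.filter_insert, if_pos h, Finset.card_insert_of_notMem (by simp [haT']), pow_succ']
        · intro b hb
          rcases Finset.mem_insert.1 hb with rfl | hb
          · exact h
          · exact haT b hb

theorem prod_mem (hq : q ≠ 0) (l : List (Fin n)) :
    (l.map (X q n)).prod ∈ Submodule.span ℂ
      (Set.range fun S : {S : Finset (Fin n) // S.card = l.length} => xS q n S.1) := by
  induction l with
  | nil =>
    apply Submodule.subset_span
    exact ⟨⟨∅, rfl⟩, by simp [xS]⟩
  | cons i l ih =>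
    rw [List.map_cons, List.prod_cons]
    have key : ∀ y ∈ Submodule.span ℂ
      (Set.range fun S : {S : Finset (Fin n) // S.card = l.length} => xS q n S.1),
      X q n i * y ∈ Submodule.span ℂ
      (Set.range fun S : {S : Finset (Fin n) // S.card = (i :: l).length} => xS q n S.1) := by
      intro y hy
      induction hy using Submodule.span_induction with
      | mem y hy =>
        obtain ⟨⟨S, hS⟩, rfl⟩ := hy
        simp only
        rw [X_mul_xS q n hq]
        split_ifs with h
        · exact zero_mem _
        · apply Submodule.smul_mem
          apply Submodule.subset_span
          exact ⟨⟨insert i S, by rw [Finset.card_insert_of_notMem h, hS, List.length_cons]⟩, rfl⟩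
      | zero => simp
      | add a b _ _ ha hb => rw [mul_add]; exact add_mem ha hb
      | smul c a _ ha => rw [mul_smul_comm]; exact Submodule.smul_mem _ _ ha
    exact key _ ih

theorem mk_prod (l : List (Fin n)) :
    RingQuot.mkAlgHom ℂ (LambdaRel q n) (l.map (FreeAlgebra.ι ℂ)).prod
      = (l.map (X q n)).prod := by
  rw [map_list_prod, List.map_map]
  rfl

theorem degree_eq (hq : q ≠ 0) (k : ℕ) :
    lambdaDegree q n k = Submodule.span ℂ
      (Set.range fun S : {S : Finset (Fin n) // S.card = k} => xS q n S.1) := by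
  unfold lambdaDegree
  apply le_antisymm
  · rw [Submodule.span_le]
    rintro _ ⟨w, rfl⟩
    rw [mk_prod]
    have h := prod_mem q n hq (List.ofFn w)
    rw [List.length_ofFn] at h
    exact h
  · rw [Submodule.span_le]
    rintro _ ⟨⟨S, hS⟩, rfl⟩
    apply Submodule.subset_span
    subst hS
    refine ⟨fun i => (S.sort (· ≤ ·)).get (i.cast (Finset.length_sort _).symm), ?_⟩
    rw [mk_prod]
    simp only [xS]
    congr 2
    apply List.ext_get
    · simp
    · intro m h1 h2
      simp

/-- the operators of left multiplication -/
noncomputable def T (i : Fin n) : Module.End ℂ (Finset (Fin n) →₀ ℂ) :=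
  Finsupp.linearCombination ℂ fun S =>
    if i ∈ S then 0 else co q n i S • Finsupp.single (insert i S) (1 : ℂ)

theorem T_single (i : Fin n) (S : Finset (Fin n)) :
    T q n i (Finsupp.single S 1)
      = if i ∈ S then 0 else co q n i S • Finsupp.single (insert i S) (1 : ℂ) := by
  simp [T]

theorem T_sq (i : Fin n) : T q n i * T q n i = 0 := by
  apply Finsupp.lhom_ext'
  intro S
  apply LinearMap.ext_ring
  simp only [LinearMap.comp_apply, Finsupp.lsingle_apply, Module.End.mul_apply, T_single]
  split_ifs with h
  · simp
  · rw [map_smul, T_single]; simp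

theorem co_insert_lt (i j : Fin n) (S : Finset (Fin n)) (hi : i ∉ S) (h : i < j) :
    co q n j (insert i S) = (-(q : ℂ)⁻¹) * co q n j S := by
  simp only [co]
  rw [Finset.filter_insert, if_pos h, Finset.card_insert_of_notMem (by simp [hi]), pow_succ']

theorem co_insert_gt (i j : Fin n) (S : Finset (Fin n)) (h : i < j) :
    co q n i (insert j S) = co q n i S := by
  simp only [co]
  rw [Finset.filter_insert, if_neg h.le.not_gt]

theorem T_comm (hq : q ≠ 0) (i j : Fin n) (hij : i < j) :
    T q n i * T q n j + (q : ℂ) • (T q n j * T q n i) = 0 := by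
  have hq' : (q : ℂ) ≠ 0 := by exact_mod_cast hq
  apply Finsupp.lhom_ext'
  intro S
  apply LinearMap.ext_ring
  simp only [LinearMap.comp_apply, Finsupp.lsingle_apply, Module.End.mul_apply, T_single,
    LinearMap.add_apply, LinearMap.smul_apply, LinearMap.zero_apply]
  by_cases hi : i ∈ S <;> by_cases hj : j ∈ S
  · simp [hi, hj]
  · rw [if_pos hi, if_neg hj, map_smul, T_single, if_pos (Finset.mem_insert_of_mem hi)]
    simp
  · rw [if_neg hi, if_pos hj, map_smul, T_single, if_pos (Finset.mem_insert_of_mem hj)]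
    simp
  · have h1 : i ∉ insert j S := by simp [hi, hij.ne]
    have h2 : j ∉ insert i S := by simp [hj, hij.ne']
    rw [if_neg hi, if_neg hj, map_smul, map_smul, T_single, T_single, if_neg h1, if_neg h2,
      co_insert_lt q n i j S hi hij, co_insert_gt q n i j S hij, Finset.insert_comm j i,
      smul_smul, smul_smul, smul_smul, ← add_smul]
    convert zero_smul ℂ _
    field_simp
    ring

noncomputable def rep (hq : q ≠ 0) : Lambda q n →ₐ[ℂ] Module.End ℂ (Finset (Fin n) →₀ ℂ) :=
  RingQuot.liftAlgHom ℂ ⟨FreeAlgebra.lift ℂ (T q n), by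
    intro x y h
    cases h with
    | sq i => simp [T_sq]
    | comm i j h =>
      rw [map_add, map_smul, map_mul, map_mul, map_zero, FreeAlgebra.lift_ι_apply,
        FreeAlgebra.lift_ι_apply]
      exact T_comm q n hq i j h⟩

theorem rep_X (hq : q ≠ 0) (i : Fin n) : rep q n hq (X q n i) = T q n i := by
  simp [rep, X]

theorem rep_xS (hq : q ≠ 0) (S : Finset (Fin n)) :
    rep q n hq (xS q n S) (Finsupp.single ∅ 1) = Finsupp.single S 1 := by
  induction S using Finset.induction_on_min with
  | empty => simp [xS]
  | insert a T haT ih =>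
    have ha : a ∉ T := fun ha => lt_irrefl _ (haT a ha)
    have hf : T.filter (· < a) = ∅ := by
      apply Finset.filter_eq_empty_iff.2
      intro b hb
      exact (haT b hb).le.not_gt
    rw [xS_insert_min q n a _ haT, map_mul, Module.End.mul_apply, ih, rep_X, T_single, if_neg ha,
      co, hf]
    simp

theorem xS_indep (hq : q ≠ 0) : LinearIndependent ℂ (xS q n) := by
  apply LinearIndependent.of_comp
    ((LinearMap.applyₗ (R := ℂ) (Finsupp.single (∅ : Finset (Fin n)) (1 : ℂ))).comp
      (rep q n hq).toLinearMap)
  have : (⇑((LinearMap.applyₗ (R := ℂ) (Finsupp.single (∅ : Finset (Fin n)) (1 : ℂ))).comp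
      (rep q n hq).toLinearMap) ∘ xS q n) = fun S => Finsupp.single S (1 : ℂ) := by
    funext S
    simpa using rep_xS q n hq S
  rw [this]
  exact Finsupp.linearIndependent_single_one ℂ (Finset (Fin n))

theorem sort_univ_eq : (Finset.univ : Finset (Fin n)).sort (· ≤ ·) = List.ofFn fun i : Fin n => i := by
  rw [Fin.sort_univ]
  exact (List.ofFn_id n).symm

end LambdaAux

/-- for `0 ≤ k ≤ n` the span of the images of the length-`k` monomials
in `Λ_q(n)` has dimension `C(n,k)`; in particular the span of the length-`n`
monomials is one-dimensional, spanned by `x_1 x_2 ⋯ x_n`, and the span of the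
monomials of length `n + 1` is zero. -/
theorem lambda_graded_dimensions (q : ℝ) (hq0 : 0 < q) (hq1 : q < 1)
    (n : ℕ) (hn : 1 ≤ n) :
    (∀ k : ℕ, k ≤ n →
      Module.finrank ℂ (lambdaDegree q n k) = n.choose k) ∧
    lambdaDegree q n n
      = Submodule.span ℂ
          {RingQuot.mkAlgHom ℂ (LambdaRel q n)
            ((List.ofFn fun i : Fin n => FreeAlgebra.ι ℂ i).prod)} ∧
    lambdaDegree q n (n + 1) = ⊥ := by
  have hq : q ≠ 0 := hq0.ne'
  refine ⟨?_, ?_, ?_⟩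
  · intro k _
    rw [LambdaAux.degree_eq q n hq]
    refine (finrank_span_eq_card
      ((LambdaAux.xS_indep q n hq).comp
        (fun S : {S : Finset (Fin n) // S.card = k} => S.1) Subtype.val_injective)).trans ?_
    simp
  · rw [LambdaAux.degree_eq q n hq]
    congr 1
    have h1 : RingQuot.mkAlgHom ℂ (LambdaRel q n)
            ((List.ofFn fun i : Fin n => FreeAlgebra.ι ℂ i).prod)
          = LambdaAux.xS q n Finset.univ := by
      rw [LambdaAux.xS, LambdaAux.sort_univ_eq, ← LambdaAux.mk_prod, List.map_ofFn]
      rfl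
    rw [h1]
    ext y
    constructor
    · rintro ⟨⟨S, hS⟩, rfl⟩
      have : S = Finset.univ := (Finset.card_eq_iff_eq_univ S).1 (by simpa using hS)
      subst this
      rfl
    · rintro rfl
      exact ⟨⟨Finset.univ, by simp⟩, rfl⟩
  · rw [LambdaAux.degree_eq q n hq, Submodule.span_eq_bot]
    rintro _ ⟨⟨S, hS⟩, rfl⟩
    have := Finset.card_le_univ S
    rw [hS, Fintype.card_fin] at this
    omega
end
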